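/- Let γ > 1, k ≥ 0, ρ > 0, r > 0, T > 0, ā > 0, N ∈ ℕ, and let h : [0, ā] → ℝ be continuous and increasing with h(0) = 0 and h(ā) > 0. Define FG_N(λ) := −N e^{−ρT} F^{*,k}( λ e^{(ρ−r)T} ) − e^{−ρT} F^{*,0}( λ e^{(ρ−r)T} ) + ∫₀^T ρ e^{−ρt} G^*( (r/ρ)·λ·e^{(ρ−r)t} ) dt for λ ≤ 0. Then the infimum of FG_N over λ ≤ 0 is attained and satisfies 0 < inf_{λ ≤ 0} FG_N(λ) < ā·(1 − e^{−ρT}). (This is the analytic content of the non-degeneracy statement in Theorem 3.1(4): the principal's first-best value at zero reservation utility satisfies 0 < V^{FB,P} < ā(1 − e^{−ρT}).) -/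

import Mathlib

/-- The concave conjugate `F^{*,k}(p) = inf_{y ≥ 0} (y·p + (1+k)·y^γ)`. -/
noncomputable def Fstar (γ k p : ℝ) : ℝ :=
  sInf ((fun y : ℝ => y * p + (1 + k) * y ^ γ) '' Set.Ici (0 : ℝ))

/-- The convex dual `G^*(p) = sup_{a ∈ [0, ā]} (a + h(a)·p)`. -/
noncomputable def Gstar (h : ℝ → ℝ) (abar p : ℝ) : ℝ :=
  sSup ((fun a : ℝ => a + h a * p) '' Set.Icc 0 abar)

/-- `FG_N(λ) = −N e^{−ρT} F^{*,k}(λ e^{(ρ−r)T}) − e^{−ρT} F^{*,0}(λ e^{(ρ−r)T})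
  + ∫₀^T ρ e^{−ρt} G^*((r/ρ)·λ·e^{(ρ−r)t}) dt`. -/
noncomputable def FGN (γ k ρ r T abar : ℝ) (h : ℝ → ℝ) (N : ℕ) (lam : ℝ) : ℝ :=
  -(N : ℝ) * Real.exp (-ρ * T) * Fstar γ k (lam * Real.exp ((ρ - r) * T))
    - Real.exp (-ρ * T) * Fstar γ 0 (lam * Real.exp ((ρ - r) * T))
    + ∫ t in (0 : ℝ)..T, ρ * Real.exp (-ρ * t) * Gstar h abar (r / ρ * lam * Real.exp ((ρ - r) * t))

lemma Fstar_term_ge {γ k : ℝ} (hγ : 1 < γ) (hk : 0 ≤ k) (p : ℝ) {y : ℝ} (hy : 0 ≤ y) :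
    -(|p| * |p| ^ (1 / (γ - 1))) ≤ y * p + (1 + k) * y ^ γ := by
  have hγ' : 0 < γ - 1 := by linarith
  have hyγ : 0 ≤ y ^ γ := Real.rpow_nonneg hy γ
  have hp : -(y * |p|) ≤ y * p := by nlinarith [neg_abs_le p]
  have hky : 0 ≤ k * y ^ γ := by positivity
  rcases le_or_gt y (|p| ^ (1 / (γ - 1))) with hle | hlt
  · have := mul_le_mul_of_nonneg_left hle (abs_nonneg p)
    linarith
  · have hy0 : 0 < y := lt_of_le_of_lt (by positivity) hlt
    have hpow : |p| ≤ y ^ (γ - 1) := by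
      have := Real.rpow_le_rpow (by positivity) hlt.le hγ'.le
      rwa [← Real.rpow_mul (abs_nonneg p), one_div_mul_cancel hγ'.ne', Real.rpow_one] at this
    have hsplit : y ^ γ = y * y ^ (γ - 1) := by
      rw [← Real.rpow_one_add' hy0.le (by linarith)]; congr 1; ring
    have h1 : y * |p| ≤ y ^ γ := by
      rw [hsplit]; exact mul_le_mul_of_nonneg_left hpow hy0.le
    have h2 : 0 ≤ |p| * |p| ^ (1 / (γ - 1)) := by positivity
    linarith

lemma Fstar_le {γ k : ℝ} (hγ : 1 < γ) (hk : 0 ≤ k) (p : ℝ) {y : ℝ} (hy : 0 ≤ y) :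
    Fstar γ k p ≤ y * p + (1 + k) * y ^ γ := by
  refine csInf_le ⟨-(|p| * |p| ^ (1 / (γ - 1))), ?_⟩ ⟨y, hy, rfl⟩
  rintro _ ⟨z, hz, rfl⟩
  exact Fstar_term_ge hγ hk p hz

lemma le_Fstar {γ k p c : ℝ} (hc : ∀ y : ℝ, 0 ≤ y → c ≤ y * p + (1 + k) * y ^ γ) :
    c ≤ Fstar γ k p := by
  refine le_csInf ⟨_, 0, Set.self_mem_Ici, rfl⟩ ?_
  rintro _ ⟨z, hz, rfl⟩
  exact hc z hz

lemma neg_le_Fstar {γ k : ℝ} (hγ : 1 < γ) (hk : 0 ≤ k) (p : ℝ) :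
    -(|p| * |p| ^ (1 / (γ - 1))) ≤ Fstar γ k p :=
  le_Fstar fun _ hy => Fstar_term_ge hγ hk p hy

lemma Fstar_nonpos {γ k : ℝ} (hγ : 1 < γ) (hk : 0 ≤ k) (p : ℝ) : Fstar γ k p ≤ 0 := by
  simpa [Real.zero_rpow (by linarith : γ ≠ 0)] using Fstar_le hγ hk p le_rfl

lemma Fstar_neg {γ k p : ℝ} (hγ : 1 < γ) (hk : 0 ≤ k) (hp : p < 0) : Fstar γ k p < 0 := by
  have hγ' : 0 < γ - 1 := by linarith
  have hb : 0 < -p / (2 * (1 + k)) := div_pos (by linarith) (by linarith)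
  set y := (-p / (2 * (1 + k))) ^ (1 / (γ - 1)) with hy
  have hy0 : 0 < y := Real.rpow_pos_of_pos hb _
  have hpow : y ^ (γ - 1) = -p / (2 * (1 + k)) := by
    rw [hy, ← Real.rpow_mul hb.le, one_div_mul_cancel hγ'.ne', Real.rpow_one]
  have hsplit : y ^ γ = y * y ^ (γ - 1) := by
    rw [← Real.rpow_one_add' hy0.le (by linarith)]; congr 1; ring
  refine (Fstar_le hγ hk p hy0.le).trans_lt ?_
  have : y * p + (1 + k) * y ^ γ = y * p / 2 := by
    rw [hsplit, hpow]
    have : (1 + k) ≠ 0 := by linarith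
    field_simp
    ring
  rw [this]
  nlinarith [mul_pos_of_neg_of_neg hp (neg_lt_zero.2 hy0)]

lemma Fstar_concaveOn {γ k : ℝ} (hγ : 1 < γ) (hk : 0 ≤ k) :
    ConcaveOn ℝ Set.univ (Fstar γ k) := by
  refine ⟨convex_univ, fun p _ q _ a b ha hb hab => le_Fstar fun y hy => ?_⟩
  have h1 := mul_le_mul_of_nonneg_left (Fstar_le hγ hk p hy) ha
  have h2 := mul_le_mul_of_nonneg_left (Fstar_le hγ hk q hy) hb
  have h3 : (1 + k) * y ^ γ = (a + b) * ((1 + k) * y ^ γ) := by rw [hab, one_mul]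
  simp only [smul_eq_mul]
  linear_combination h1 + h2 - h3

lemma continuous_Fstar {γ k : ℝ} (hγ : 1 < γ) (hk : 0 ≤ k) : Continuous (Fstar γ k) :=
  continuousOn_univ.1 ((Fstar_concaveOn hγ hk).continuousOn isOpen_univ)

section Gstar

variable {h : ℝ → ℝ} {abar : ℝ}

lemma Gstar_le {p c : ℝ} (habar : 0 ≤ abar) (hc : ∀ a ∈ Set.Icc 0 abar, a + h a * p ≤ c) :
    Gstar h abar p ≤ c := by
  refine csSup_le ⟨_, 0, Set.left_mem_Icc.2 habar, rfl⟩ ?_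
  rintro _ ⟨a, ha, rfl⟩
  exact hc a ha

lemma le_Gstar (hcont : ContinuousOn h (Set.Icc 0 abar)) (p : ℝ) {a : ℝ}
    (ha : a ∈ Set.Icc 0 abar) : a + h a * p ≤ Gstar h abar p :=
  le_csSup (isCompact_Icc.bddAbove_image
    (continuousOn_id.add (hcont.mul continuousOn_const))) ⟨a, ha, rfl⟩

lemma Gstar_convexOn (habar : 0 ≤ abar) (hcont : ContinuousOn h (Set.Icc 0 abar)) :
    ConvexOn ℝ Set.univ (Gstar h abar) := by
  refine ⟨convex_univ, fun p _ q _ s t hs ht hst => Gstar_le habar fun a ha => ?_⟩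
  have h1 := mul_le_mul_of_nonneg_left (le_Gstar hcont p ha) hs
  have h2 := mul_le_mul_of_nonneg_left (le_Gstar hcont q ha) ht
  have h3 : a = (s + t) * a := by rw [hst, one_mul]
  simp only [smul_eq_mul]
  linear_combination h1 + h2 + h3

lemma continuous_Gstar (habar : 0 ≤ abar) (hcont : ContinuousOn h (Set.Icc 0 abar)) :
    Continuous (Gstar h abar) :=
  continuousOn_univ.1 ((Gstar_convexOn habar hcont).continuousOn isOpen_univ)

lemma Gstar_nonneg (habar : 0 ≤ abar) (hcont : ContinuousOn h (Set.Icc 0 abar)) (h0 : h 0 = 0)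
    (p : ℝ) : 0 ≤ Gstar h abar p := by
  simpa [h0] using le_Gstar hcont p (Set.left_mem_Icc.2 habar)

/-- Near `p = 0` the function `Gstar` decreases at least linearly as `p` decreases. -/
lemma exists_Gstar_le (habar : 0 ≤ abar) (hcont : ContinuousOn h (Set.Icc 0 abar))
    (hmono : MonotoneOn h (Set.Icc 0 abar)) (h0 : h 0 = 0) (hpos : 0 < h abar) :
    ∃ η > 0, ∀ p, -η ≤ p → p ≤ 0 → Gstar h abar p ≤ abar + h abar / 2 * p := by
  have hmem : abar ∈ Set.Icc 0 abar := Set.right_mem_Icc.2 habar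
  obtain ⟨δ, hδ, hclose⟩ := Metric.continuousWithinAt_iff.1 (hcont abar hmem) (h abar / 2)
    (by linarith)
  refine ⟨2 * δ / h abar, by positivity, fun p hp hp0 => Gstar_le habar fun a ha => ?_⟩
  have hp' : -(2 * δ) ≤ p * h abar := by
    have := mul_le_mul_of_nonneg_right hp hpos.le
    rwa [neg_mul, div_mul_cancel₀ _ hpos.ne'] at this
  rcases lt_or_ge (abar - a) δ with hlt | hge
  · have hd := hclose ha (by rw [Real.dist_eq, abs_sub_comm, abs_of_nonneg] <;> linarith [ha.2])
    rw [Real.dist_eq] at hd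
    have := (abs_lt.1 hd).1
    nlinarith [ha.2]
  · have : 0 ≤ h a := h0 ▸ hmono (Set.left_mem_Icc.2 habar) ha ha.1
    nlinarith

end Gstar

lemma integral_mul_exp_neg (ρ T : ℝ) :
    ∫ t in (0 : ℝ)..T, ρ * Real.exp (-ρ * t) = 1 - Real.exp (-ρ * T) := by
  have hderiv : ∀ t ∈ Set.uIcc 0 T,
      HasDerivAt (fun t => -Real.exp (-ρ * t)) (ρ * Real.exp (-ρ * t)) t := fun t _ => by
    have := (((hasDerivAt_id' t).const_mul (-ρ)).exp).neg
    rwa [mul_one, mul_neg, neg_neg, mul_comm] at this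
  rw [intervalIntegral.integral_eq_sub_of_hasDerivAt hderiv
    ((by fun_prop : Continuous fun t => ρ * Real.exp (-ρ * t)).intervalIntegrable _ _)]
  simp
  ring

section FGN

variable {γ k ρ r T abar : ℝ} {h : ℝ → ℝ} (N : ℕ)

lemma continuous_FGN_integrand (habar : 0 ≤ abar) (hcont : ContinuousOn h (Set.Icc 0 abar)) :
    Continuous fun x : ℝ × ℝ =>
      ρ * Real.exp (-ρ * x.2) * Gstar h abar (r / ρ * x.1 * Real.exp ((ρ - r) * x.2)) := by
  have := continuous_Gstar habar hcont
  fun_prop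

lemma continuous_FGN (hγ : 1 < γ) (hk : 0 ≤ k) (habar : 0 ≤ abar)
    (hcont : ContinuousOn h (Set.Icc 0 abar)) : Continuous (FGN γ k ρ r T abar h N) := by
  have h1 := continuous_Fstar hγ hk
  have h2 := continuous_Fstar hγ le_rfl
  have h3 : Continuous fun lam : ℝ => ∫ t in (0 : ℝ)..T,
      ρ * Real.exp (-ρ * t) * Gstar h abar (r / ρ * lam * Real.exp ((ρ - r) * t)) :=
    intervalIntegral.continuous_parametric_intervalIntegral_of_continuous'
      (continuous_FGN_integrand habar hcont) 0 T
  unfold FGN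
  fun_prop

lemma neg_Fstar_le_FGN (hγ : 1 < γ) (hk : 0 ≤ k) (hρ : 0 ≤ ρ) (hT : 0 ≤ T) (habar : 0 ≤ abar)
    (hcont : ContinuousOn h (Set.Icc 0 abar)) (h0 : h 0 = 0) (lam : ℝ) :
    -(Real.exp (-ρ * T) * Fstar γ 0 (lam * Real.exp ((ρ - r) * T))) ≤
      FGN γ k ρ r T abar h N lam := by
  have h1 : 0 ≤ ∫ t in (0 : ℝ)..T,
      ρ * Real.exp (-ρ * t) * Gstar h abar (r / ρ * lam * Real.exp ((ρ - r) * t)) :=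
    intervalIntegral.integral_nonneg hT fun t _ =>
      mul_nonneg (by positivity) (Gstar_nonneg habar hcont h0 _)
  have h2 : 0 ≤ (N : ℝ) * Real.exp (-ρ * T) * -Fstar γ k (lam * Real.exp ((ρ - r) * T)) :=
    mul_nonneg (by positivity) (neg_nonneg.2 (Fstar_nonpos hγ hk _))
  unfold FGN
  linarith

lemma FGN_pos (hγ : 1 < γ) (hk : 0 ≤ k) (hρ : 0 < ρ) (hT : 0 < T) (habar : 0 < abar)
    (hcont : ContinuousOn h (Set.Icc 0 abar)) (h0 : h 0 = 0) {lam : ℝ} (hlam : lam ≤ 0) :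
    0 < FGN γ k ρ r T abar h N lam := by
  rcases hlam.lt_or_eq with hneg | rfl
  · refine lt_of_lt_of_le ?_ (neg_Fstar_le_FGN N hγ hk hρ.le hT.le habar.le hcont h0 lam)
    have := Fstar_neg hγ le_rfl (mul_neg_of_neg_of_pos hneg (Real.exp_pos ((ρ - r) * T)))
    exact neg_pos.2 (mul_neg_of_pos_of_neg (Real.exp_pos _) this)
  · have hG : 0 < Gstar h abar 0 := by
      have := le_Gstar hcont 0 (Set.right_mem_Icc.2 habar.le)
      linarith
    have hF1 := Fstar_nonpos hγ hk 0
    have hF2 := Fstar_nonpos hγ le_rfl 0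
    have hexp : Real.exp (-ρ * T) < 1 := Real.exp_lt_one_iff.2 (by nlinarith)
    unfold FGN
    simp only [mul_zero, zero_mul, intervalIntegral.integral_mul_const, integral_mul_exp_neg ρ T]
    have h1 : 0 ≤ (N : ℝ) * Real.exp (-ρ * T) * -Fstar γ k 0 :=
      mul_nonneg (by positivity) (by linarith)
    have h2 : 0 ≤ Real.exp (-ρ * T) * -Fstar γ 0 0 := mul_nonneg (by positivity) (by linarith)
    have h3 : 0 < (1 - Real.exp (-ρ * T)) * Gstar h abar 0 := mul_pos (by linarith) hG
    linarith

lemma tendsto_FGN_atBot (hγ : 1 < γ) (hk : 0 ≤ k) (hρ : 0 ≤ ρ) (hT : 0 ≤ T) (habar : 0 ≤ abar)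
    (hcont : ContinuousOn h (Set.Icc 0 abar)) (h0 : h 0 = 0) :
    Filter.Tendsto (FGN γ k ρ r T abar h N) Filter.atBot Filter.atTop := by
  refine Filter.tendsto_atTop_mono (f := fun lam => (Real.exp (-ρ * T) *
    Real.exp ((ρ - r) * T)) * -lam + -Real.exp (-ρ * T)) (fun lam => ?_) ?_
  · refine le_trans ?_ (neg_Fstar_le_FGN N hγ hk hρ hT habar hcont h0 lam)
    have hF := Fstar_le hγ le_rfl (lam * Real.exp ((ρ - r) * T)) zero_le_one
    rw [Real.one_rpow] at hF
    have := mul_le_mul_of_nonneg_left hF (Real.exp_pos (-ρ * T)).le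
    linarith
  · exact Filter.tendsto_atTop_add_const_right _ _
      (Filter.tendsto_neg_atBot_atTop.const_mul_atTop (by positivity))

lemma exists_FGN_lt (hγ : 1 < γ) (hk : 0 ≤ k) (hρ : 0 < ρ) (hr : 0 < r) (hT : 0 < T)
    (habar : 0 ≤ abar) (hcont : ContinuousOn h (Set.Icc 0 abar))
    (hmono : MonotoneOn h (Set.Icc 0 abar)) (h0 : h 0 = 0) (hpos : 0 < h abar) :
    ∃ lam ≤ 0, FGN γ k ρ r T abar h N lam < abar * (1 - Real.exp (-ρ * T)) := by
  obtain ⟨η, hη, hG⟩ := exists_Gstar_le habar hcont hmono h0 hpos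
  have hγ' : 0 < 1 / (γ - 1) := one_div_pos.2 (by linarith)
  set α := 1 / (γ - 1)
  set c := Real.exp ((ρ - r) * T)
  have hc0 : 0 < c := Real.exp_pos _
  set J := ∫ t in (0 : ℝ)..T, ρ * Real.exp (-ρ * t) * Real.exp ((ρ - r) * t)
  have hJ : 0 < J := intervalIntegral.intervalIntegral_pos_of_pos
    ((by fun_prop : Continuous fun t =>
      ρ * Real.exp (-ρ * t) * Real.exp ((ρ - r) * t)).intervalIntegrable _ _)
    (fun t => by positivity) hT
  set M := Real.exp (|ρ - r| * T)
  have hM0 : 0 < M := Real.exp_pos _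
  have hlim : Filter.Tendsto (fun ε : ℝ => ((N + 1) * Real.exp (-ρ * T)) * (c * (ε * c) ^ α))
      (nhdsWithin 0 (Set.Ioi 0)) (nhds 0) := by
    have : Continuous fun ε : ℝ => ((N + 1) * Real.exp (-ρ * T)) * (c * (ε * c) ^ α) := by
      have := Real.continuous_rpow_const hγ'.le
      fun_prop
    have h1 := this.tendsto 0
    rw [zero_mul, Real.zero_rpow hγ'.ne', mul_zero, mul_zero] at h1
    exact h1.mono_left nhdsWithin_le_nhds
  have hlim2 : Filter.Tendsto (fun ε : ℝ => r / ρ * ε * M)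
      (nhdsWithin 0 (Set.Ioi 0)) (nhds 0) := by
    have h1 := (by fun_prop : Continuous fun ε : ℝ => r / ρ * ε * M).tendsto 0
    rw [mul_zero, zero_mul] at h1
    exact h1.mono_left nhdsWithin_le_nhds
  have hK : 0 < h abar / 2 * (r / ρ) * J := by positivity
  obtain ⟨ε, ⟨hε1, hε2⟩, hε⟩ := ((hlim.eventually_lt_const hK).and
    (hlim2.eventually_lt_const hη) |>.and self_mem_nhdsWithin).exists
  have hε : 0 < ε := hε
  refine ⟨-ε, by linarith, ?_⟩
  have hint : (∫ t in (0 : ℝ)..T,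
      ρ * Real.exp (-ρ * t) * Gstar h abar (r / ρ * (-ε) * Real.exp ((ρ - r) * t))) ≤
      abar * (1 - Real.exp (-ρ * T)) - h abar / 2 * (r / ρ) * ε * J := by
    have hrhs : abar * (1 - Real.exp (-ρ * T)) - h abar / 2 * (r / ρ) * ε * J =
        ∫ t in (0 : ℝ)..T, (abar * (ρ * Real.exp (-ρ * t)) -
          h abar / 2 * (r / ρ) * ε * (ρ * Real.exp (-ρ * t) * Real.exp ((ρ - r) * t))) := by
      rw [← integral_mul_exp_neg, intervalIntegral.integral_sub (Continuous.intervalIntegrable (by fun_prop) _ _)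
        (Continuous.intervalIntegrable (by fun_prop) _ _), intervalIntegral.integral_const_mul abar,
        intervalIntegral.integral_const_mul (h abar / 2 * (r / ρ) * ε)]
    rw [hrhs]
    refine intervalIntegral.integral_mono_on hT.le
      (((continuous_FGN_integrand (ρ := ρ) (r := r) habar hcont).comp
        (by fun_prop : Continuous fun t : ℝ => (-ε, t))).intervalIntegrable _ _)
      (Continuous.intervalIntegrable (by fun_prop) _ _) fun t ht => ?_
    have hexp : Real.exp ((ρ - r) * t) ≤ M := by
      refine Real.exp_le_exp.2 ?_
      calc (ρ - r) * t ≤ |ρ - r| * t := mul_le_mul_of_nonneg_right (le_abs_self _) ht.1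
        _ ≤ |ρ - r| * T := mul_le_mul_of_nonneg_left ht.2 (abs_nonneg _)
    have hq : r / ρ * ε * Real.exp ((ρ - r) * t) ≤ r / ρ * ε * M :=
      mul_le_mul_of_nonneg_left hexp (by positivity)
    have hq0 : 0 ≤ r / ρ * ε * Real.exp ((ρ - r) * t) := by positivity
    have hg := hG (r / ρ * (-ε) * Real.exp ((ρ - r) * t)) (by linarith) (by linarith)
    have := mul_le_mul_of_nonneg_left hg (by positivity : 0 ≤ ρ * Real.exp (-ρ * t))
    linarith
  have hF : ∀ κ : ℝ, 0 ≤ κ → -Fstar γ κ (-ε * c) ≤ ε * c * (ε * c) ^ α := fun κ hκ => by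
    have := neg_le_Fstar hγ hκ (-ε * c)
    rw [neg_mul, abs_neg, abs_of_pos (mul_pos hε hc0)] at this
    rw [neg_mul]
    linarith
  have hF1 := mul_le_mul_of_nonneg_left (hF k hk)
    (by positivity : 0 ≤ (N : ℝ) * Real.exp (-ρ * T))
  have hF2 := mul_le_mul_of_nonneg_left (hF 0 le_rfl) (Real.exp_pos (-ρ * T)).le
  have hε3 := mul_lt_mul_of_pos_left hε1 hε
  unfold FGN
  linarith

end FGN

/-- (with additionally `h(ā) > 0`) the infimum of `FG_N` over `λ ≤ 0`
is attained and satisfies `0 < inf_{λ ≤ 0} FG_N(λ) < ā(1 − e^{−ρT})` — the analytic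
content of the non-degeneracy of the first-best value at zero reservation utility. -/
theorem statement8 (γ k ρ r T abar : ℝ) (h : ℝ → ℝ) (N : ℕ)
    (hγ : 1 < γ) (hk : 0 ≤ k) (hρ : 0 < ρ) (hr : 0 < r) (hT : 0 < T) (habar : 0 < abar)
    (hcont : ContinuousOn h (Set.Icc 0 abar))
    (hmono : MonotoneOn h (Set.Icc 0 abar)) (h0 : h 0 = 0) (hpos : 0 < h abar) :
    (∃ lam0 ≤ (0 : ℝ), ∀ lam ≤ (0 : ℝ),
      FGN γ k ρ r T abar h N lam0 ≤ FGN γ k ρ r T abar h N lam) ∧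
    0 < sInf (FGN γ k ρ r T abar h N '' Set.Iic 0) ∧
    sInf (FGN γ k ρ r T abar h N '' Set.Iic 0) < abar * (1 - Real.exp (-ρ * T)) := by
  obtain ⟨lam0, hlam0, hmin⟩ : ∃ lam0 ∈ Set.Iic (0 : ℝ),
      IsMinOn (FGN γ k ρ r T abar h N) (Set.Iic 0) lam0 := by
    refine (continuous_FGN N hγ hk habar.le hcont).continuousOn.exists_isMinOn' isClosed_Iic
      Set.self_mem_Iic ?_
    have hev := (tendsto_FGN_atBot (r := r) N hγ hk hρ.le hT.le habar.le
      hcont h0).eventually_ge_atTop (FGN γ k ρ r T abar h N 0)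
    obtain ⟨b, hb⟩ := Filter.eventually_atBot.1 hev
    rw [Filter.eventually_inf_principal]
    filter_upwards [(isCompact_Icc (a := b) (b := (0 : ℝ))).compl_mem_cocompact] with lam hlam hle
    exact hb lam (le_of_not_ge fun hge => hlam ⟨hge, hle⟩)
  have hleast : IsLeast (FGN γ k ρ r T abar h N '' Set.Iic 0) (FGN γ k ρ r T abar h N lam0) :=
    ⟨⟨lam0, hlam0, rfl⟩, by rintro _ ⟨lam, hlam, rfl⟩; exact hmin hlam⟩
  refine ⟨⟨lam0, hlam0, fun lam hlam => hmin hlam⟩, ?_⟩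
  rw [hleast.csInf_eq]
  refine ⟨FGN_pos N hγ hk hρ hT habar hcont h0 hlam0, ?_⟩
  obtain ⟨lam, hlam, hlt⟩ := exists_FGN_lt N hγ hk hρ hr hT habar.le hcont hmono h0 hpos
  exact (hmin hlam).trans_lt hlt
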